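/- For σ > 0 and z ∈ ℂ let K̃₀(σ, z) = −(πσ)^{−1/2} Σ_{m ∈ ℤ, m ≠ 0} e^{−(z + 2mπ)²/(4σ)}, and for τ > 0 and f ∈ L²((0,τ)) define (R_{0,τ} f)(s) = ∫₀^τ (∂K̃₀/∂s)(τ − σ, s) f(σ) dσ. Then there exists C(τ) ≥ 0 with C(τ) → 0 as τ → 0 such that for every f ∈ L²((0,τ)) there exist g₁ holomorphic on Δ and g₂ holomorphic on π − Δ with R_{0,τ} f = g₁|_D + g₂|_D and ∫_Δ |g₁|² ω₀ dA + ∫_{π−Δ} |g₂|² ω_π dA ≤ C(τ)² ∫₀^τ |f(σ)|² dσ, where ω₀(z) = e^{Re(z²)/(2τ)}/τ and ω_π(z) = ω₀(π − z). -/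

import Mathlib

open MeasureTheory Set

noncomputable section

/-- The open sector `Δ = {z : |arg z| < π/4}`. -/
def SectorDelta : Set ℂ := {z : ℂ | 0 < z.re ∧ |z.im| < z.re}

/-- The reflected sector `π − Δ`. -/
def SectorPiDelta : Set ℂ := (fun z => (Real.pi : ℂ) - z) '' SectorDelta

/-- The open square `D = Δ ∩ (π − Δ)` with vertices `0, π/2 − iπ/2, π, π/2 + iπ/2`. -/
def SquareD : Set ℂ := SectorDelta ∩ SectorPiDelta

/-- Membership in the Bergman space `A²(Ω)`. -/
def MemA2 (Ω : Set ℂ) (f : ℂ → ℂ) : Prop :=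
  DifferentiableOn ℂ f Ω ∧ ∫⁻ z in Ω, ENNReal.ofReal (‖f z‖ ^ 2) < ⊤

/-- Membership in the weighted Bergman space `A²(Ω, w)`. -/
def MemA2W (Ω : Set ℂ) (w : ℂ → ℝ) (f : ℂ → ℂ) : Prop :=
  DifferentiableOn ℂ f Ω ∧ ∫⁻ z in Ω, ENNReal.ofReal (‖f z‖ ^ 2 * w z) < ⊤

/-- `log⁺ t = max (log t) 0`. -/
def logPlus (t : ℝ) : ℝ := Real.log (max t 1)

/-- Starting vertices of the four sides of `∂D`, counterclockwise. -/
def sideStart : Fin 4 → ℂ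
  | 0 => 0
  | 1 => ((Real.pi / 2 : ℝ) : ℂ) * (1 - Complex.I)
  | 2 => ((Real.pi : ℝ) : ℂ)
  | 3 => ((Real.pi / 2 : ℝ) : ℂ) * (1 + Complex.I)

/-- Direction vectors of the four sides of `∂D`, counterclockwise. -/
def sideDir : Fin 4 → ℂ
  | 0 => ((Real.pi / 2 : ℝ) : ℂ) * (1 - Complex.I)
  | 1 => ((Real.pi / 2 : ℝ) : ℂ) * (1 + Complex.I)
  | 2 => ((Real.pi / 2 : ℝ) : ℂ) * (Complex.I - 1)
  | 3 => -(((Real.pi / 2 : ℝ) : ℂ) * (1 + Complex.I))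

/-- Parametrization of the `k`-th side of `∂D`. -/
def sidePath (k : Fin 4) (t : ℝ) : ℂ := sideStart k + (t : ℂ) * sideDir k

/-- `g` is arclength-integrable on `∂D` (each side has constant speed). -/
def BoundaryIntegrable (g : ℂ → ℂ) : Prop :=
  ∀ k : Fin 4, IntervalIntegrable (fun t => ‖g (sidePath k t)‖) volume 0 1

/-- `∫_{∂D} |g| log⁺|g| |du| < ∞` (each side has constant speed). -/
def BoundaryLlogL (g : ℂ → ℂ) : Prop :=
  ∀ k : Fin 4, IntervalIntegrable
    (fun t => ‖g (sidePath k t)‖ * logPlus ‖g (sidePath k t)‖) volume 0 1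

/-- The Cauchy integral `(1/(2πi)) ∮_{∂D} g(u)/(u − z) du`, `∂D` counterclockwise. -/
def cauchyD (g : ℂ → ℂ) (z : ℂ) : ℂ :=
  (2 * (Real.pi : ℂ) * Complex.I)⁻¹ *
    ∑ k : Fin 4, ∫ t in (0:ℝ)..1, g (sidePath k t) * sideDir k / (sidePath k t - z)

/-- The Cauchy transform `(𝒞g)(z) = (1/(iπ)) ∫_ℝ g(t)/(t − z) dt` on the upper half-plane. -/
def cauchyTransform (g : ℝ → ℂ) (z : ℂ) : ℂ :=
  (Complex.I * (Real.pi : ℂ))⁻¹ * ∫ t : ℝ, g t / ((t : ℂ) - z)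


/-- `K̃₀(σ, z) = −(πσ)^{−1/2} Σ_{m ∈ ℤ, m ≠ 0} e^{−(z + 2mπ)²/(4σ)}`. -/
def Ktilde (σ : ℝ) (z : ℂ) : ℂ :=
  -(((Real.sqrt (Real.pi * σ) : ℝ) : ℂ))⁻¹ *
    ∑' m : {m : ℤ // m ≠ 0},
      Complex.exp (-(z + 2 * ((m : ℤ) : ℂ) * (Real.pi : ℂ)) ^ 2 / (4 * (σ : ℂ)))

/-- The remainder operator `(R_{0,τ} f)(s) = ∫₀^τ (∂K̃₀/∂s)(τ − σ, s) f(σ) dσ`. -/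
def Rop (τ : ℝ) (f : ℝ → ℂ) (s : ℂ) : ℂ :=
  ∫ σ in Ioo (0:ℝ) τ, deriv (Ktilde (τ - σ)) s * f σ

/-- The weight `ω₀(z) = e^{Re(z²)/(2τ)}/τ`. -/
def omega0 (τ : ℝ) (z : ℂ) : ℝ := Real.exp ((z ^ 2).re / (2 * τ)) / τ

/-- The weight `ω_π(z) = ω₀(π − z)`. -/
def omegaPi (τ : ℝ) (z : ℂ) : ℝ := omega0 τ ((Real.pi : ℂ) - z)

lemma sectorDelta_isOpen : IsOpen SectorDelta := by
  have h1 : IsOpen {z : ℂ | 0 < z.re} := isOpen_lt continuous_const Complex.continuous_re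
  have h2 : IsOpen {z : ℂ | |z.im| < z.re} :=
    isOpen_lt (continuous_abs.comp Complex.continuous_im) Complex.continuous_re
  exact h1.inter h2

lemma mem_sectorPiDelta (z : ℂ) : z ∈ SectorPiDelta ↔ (Real.pi : ℂ) - z ∈ SectorDelta := by
  constructor
  · rintro ⟨w, hw, rfl⟩
    simpa using hw
  · intro h
    exact ⟨_, h, by simp⟩

lemma sectorPiDelta_isOpen : IsOpen SectorPiDelta := by
  have : SectorPiDelta = (fun z : ℂ => (Real.pi : ℂ) - z) ⁻¹' SectorDelta := by
    ext z; exact mem_sectorPiDelta z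
  rw [this]
  exact sectorDelta_isOpen.preimage (by fun_prop)

/-- Holomorphy of parametric integrals. -/
lemma holo_integral {μ : Measure ℝ} {U : Set ℂ} (hU : IsOpen U) (F : ℂ → ℝ → ℂ)
    (bound : ℝ → ℝ) (hb : Integrable bound μ)
    (hm : ∀ z ∈ U, AEStronglyMeasurable (F z) μ)
    (hd : ∀ᵐ a ∂μ, DifferentiableOn ℂ (fun z => F z a) U)
    (hle : ∀ᵐ a ∂μ, ∀ z ∈ U, ‖F z a‖ ≤ bound a) :
    DifferentiableOn ℂ (fun z => ∫ a, F z a ∂μ) U := by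
  intro z₀ hz₀
  apply DifferentiableAt.differentiableWithinAt
  obtain ⟨r, hr, hrU⟩ := Metric.isOpen_iff.1 hU z₀ hz₀
  have hr2 : 0 < r / 2 := by positivity
  have hsub : ∀ z ∈ Metric.ball z₀ (r / 2), Metric.closedBall z (r / 4) ⊆ U := by
    intro z hz w hw
    apply hrU
    rw [Metric.mem_ball] at *
    rw [Metric.mem_closedBall] at hw
    linarith [dist_triangle w z z₀]
  have key := hasDerivAt_integral_of_dominated_loc_of_deriv_le (μ := μ) (𝕜 := ℂ) (F := F)
    (F' := fun z a => deriv (fun z => F z a) z) (x₀ := z₀) (s := Metric.ball z₀ (r / 2))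
    (bound := fun a => bound a / (r / 4))
    (Metric.ball_mem_nhds _ hr2)
    (Filter.eventually_of_mem (hU.mem_nhds hz₀) hm)
    (hb.mono' (hm z₀ hz₀) (hle.mono fun a ha => ha z₀ hz₀)) ?_ ?_ (hb.div_const _) ?_
  · exact key.2.differentiableAt
  · -- measurability of the derivative as a limit of difference quotients
    have hh : ∀ n : ℕ, z₀ + ((r / 2 / ((n : ℝ) + 1) : ℝ) : ℂ) ∈ U := by
      intro n
      apply hrU
      rw [Metric.mem_ball, dist_eq_norm]
      simp only [add_sub_cancel_left, Complex.norm_real, Real.norm_eq_abs]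
      rw [abs_of_pos (by positivity)]
      calc r / 2 / ((n : ℝ) + 1) ≤ r / 2 := div_le_self hr2.le (by linarith [n.cast_nonneg (α := ℝ)])
        _ < r := by linarith
    have hlim : Filter.Tendsto (fun n : ℕ => ((r / 2 / ((n : ℝ) + 1) : ℝ) : ℂ)) Filter.atTop
        (nhdsWithin 0 {0}ᶜ) := by
      rw [tendsto_nhdsWithin_iff]
      constructor
      · have h1 := (tendsto_one_div_add_atTop_nhds_zero_nat (𝕜 := ℝ)).const_mul (r / 2)
        have h2 := (Complex.continuous_ofReal.tendsto _).comp h1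
        simpa [Function.comp_def, div_eq_mul_inv] using h2
      · refine Filter.Eventually.of_forall fun n => ?_
        have : r / 2 / ((n : ℝ) + 1) ≠ 0 := by positivity
        simpa using Complex.ofReal_ne_zero.2 this
    refine aestronglyMeasurable_of_tendsto_ae Filter.atTop
      (f := fun (n : ℕ) a => (((r / 2 / ((n : ℝ) + 1) : ℝ) : ℂ))⁻¹ •
        (F (z₀ + ((r / 2 / ((n : ℝ) + 1) : ℝ) : ℂ)) a - F z₀ a)) ?_ ?_
    · intro n
      exact ((hm _ (hh n)).sub (hm _ hz₀)).const_smul ((((r / 2 / ((n : ℝ) + 1) : ℝ) : ℂ))⁻¹)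
    · filter_upwards [hd] with a ha
      have := ((ha z₀ hz₀).differentiableAt (hU.mem_nhds hz₀)).hasDerivAt
      rw [hasDerivAt_iff_tendsto_slope_zero] at this
      exact this.comp hlim
  · filter_upwards [hd, hle] with a ha hla z hz
    apply Complex.norm_deriv_le_of_forall_mem_sphere_norm_le (by positivity)
    · exact (ha.mono (hsub z hz)).diffContOnCl_ball subset_rfl
    · intro w hw
      exact hla w (hsub z hz (Metric.sphere_subset_closedBall hw))
  · filter_upwards [hd] with a ha z hz
    have hzU : z ∈ U := hsub z hz (Metric.mem_closedBall_self (by positivity))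
    exact ((ha z hzU).differentiableAt (hU.mem_nhds hzU)).hasDerivAt

/-- Cauchy–Schwarz on `(0,τ)`. -/
lemma cs_Ioo {τ : ℝ} (hτ : 0 < τ) (h : ℝ → ℝ) (h1 : IntegrableOn h (Ioo 0 τ))
    (h2 : IntegrableOn (fun σ => h σ ^ 2) (Ioo 0 τ)) :
    (∫ σ in Ioo 0 τ, h σ) ^ 2 ≤ τ * ∫ σ in Ioo 0 τ, h σ ^ 2 := by
  set J := ∫ σ in Ioo 0 τ, h σ
  have h0 : 0 ≤ ∫ σ in Ioo 0 τ, (h σ - J / τ) ^ 2 := integral_nonneg fun _ => sq_nonneg _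
  have hc : Integrable (fun _ : ℝ => (J / τ) ^ 2) (volume.restrict (Ioo 0 τ)) := by
    apply integrable_const
  have e : ∫ σ in Ioo 0 τ, (h σ - J / τ) ^ 2
      = (∫ σ in Ioo 0 τ, h σ ^ 2) - 2 * (J / τ) * J + τ * (J / τ) ^ 2 := by
    have : ∀ σ, (h σ - J / τ) ^ 2 = h σ ^ 2 - 2 * (J / τ) * h σ + (J / τ) ^ 2 := by
      intro σ; ring
    simp_rw [this]
    have h3 : Integrable (fun σ => 2 * (J / τ) * h σ) (volume.restrict (Ioo 0 τ)) :=
      h1.const_mul _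
    have h4 : Integrable (fun σ => h σ ^ 2 - 2 * (J / τ) * h σ) (volume.restrict (Ioo 0 τ)) :=
      Integrable.sub h2 h3
    rw [integral_add h4 hc, integral_sub h2 h3, integral_const_mul]
    simp [hτ.le, J]
  rw [e] at h0
  have : τ * ((∫ σ in Ioo 0 τ, h σ ^ 2) - 2 * (J / τ) * J + τ * (J / τ) ^ 2)
    = τ * (∫ σ in Ioo 0 τ, h σ ^ 2) - J ^ 2 := by field_simp; ring
  nlinarith [mul_nonneg hτ.le h0]

lemma exp_bound {X t : ℝ} (hX : 0 < X) (ht : 0 < t) :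
    Real.exp (-X / (4 * t)) ≤ 720 * 4 ^ 6 * t ^ 6 / X ^ 6 := by
  have h := Real.pow_div_factorial_le_exp (x := X / (4 * t)) (by positivity) 6
  rw [neg_div, Real.exp_neg]
  have h6 : (Nat.factorial 6 : ℝ) = 720 := by norm_num [Nat.factorial]
  rw [h6] at h
  have hp : 0 < (X / (4 * t)) ^ 6 / 720 := by positivity
  calc (Real.exp (X / (4 * t)))⁻¹ ≤ ((X / (4 * t)) ^ 6 / 720)⁻¹ := inv_anti₀ hp h
    _ = _ := by field_simp

/-- Terms of the half-theta series. -/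
def Fterm (b t : ℝ) (z : ℂ) : ℂ := Complex.exp (-(z + (b : ℂ)) ^ 2 / (4 * (t : ℂ)))

lemma norm_Fterm (b t : ℝ) (z : ℂ) :
    ‖Fterm b t z‖ = Real.exp (-((z ^ 2).re + 2 * b * z.re + b ^ 2) / (4 * t)) := by
  rw [Fterm, Complex.norm_exp]
  congr 1
  have : (4 * (t : ℂ)) = ((4 * t : ℝ) : ℂ) := by push_cast; ring
  rw [this, Complex.div_ofReal_re]
  congr 1
  simp [pow_two]
  ring

lemma re_sq_pos {z : ℂ} (hz : z ∈ SectorDelta) : 0 ≤ (z ^ 2).re := by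
  obtain ⟨h1, h2⟩ := hz
  simp only [pow_two, Complex.mul_re]
  nlinarith [abs_lt.1 h2]

lemma norm_le_two_re {z : ℂ} (hz : z ∈ SectorDelta) : ‖z‖ ≤ 2 * z.re := by
  obtain ⟨h1, h2⟩ := hz
  have := Complex.norm_le_abs_re_add_abs_im z
  rw [abs_of_pos h1] at this
  linarith

lemma norm_Fterm_le {b t τ : ℝ} {z : ℂ} (hz : z ∈ SectorDelta) (hb : 1 ≤ b) (ht : 0 < t)
    (htτ : t ≤ τ) :
    ‖Fterm b t z‖ ≤ Real.exp (-(z ^ 2).re / (4 * τ)) * (720 * 4 ^ 6 * t ^ 6 / (z.re + b) ^ 6) := by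
  have hx : 0 < z.re := hz.1
  rw [norm_Fterm]
  have hX : 0 < z.re + b := by linarith
  refine le_trans ?_ (mul_le_mul_of_nonneg_left (exp_bound hX ht) (Real.exp_nonneg _))
  rw [← Real.exp_add]
  apply Real.exp_le_exp.2
  have h1 : (z ^ 2).re / (4 * τ) ≤ (z ^ 2).re / (4 * t) :=
    div_le_div_of_nonneg_left (re_sq_pos hz) (by positivity) (by linarith)
  have h2 : (z.re + b) / (4 * t) ≤ (2 * b * z.re + b ^ 2) / (4 * t) := by
    apply div_le_div_of_nonneg_right _ (by positivity)
    nlinarith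
  rw [neg_div, neg_div, neg_div, add_assoc, add_div]
  linarith

lemma hasDerivAt_Fterm (b t : ℝ) (z : ℂ) :
    HasDerivAt (Fterm b t) (-(z + b) / (2 * t) * Fterm b t z) z := by
  have h := (((((hasDerivAt_id z).add_const (b : ℂ)).pow 2).neg).div_const (4 * (t : ℂ))).cexp
  convert! h using 1
  simp only [Fterm, id, Pi.neg_apply, Pi.pow_apply]
  by_cases ht : (t : ℂ) = 0
  · simp [ht]
  · simp
    field_simp
    ring

def Cst : ℝ := 720 * 4 ^ 6 * 8

lemma norm_deriv_Fterm_le {b t τ : ℝ} {z : ℂ} (n : ℕ) (hz : z ∈ SectorDelta) (hb : (n : ℝ) + 1 ≤ b)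
    (ht : 0 < t) (htτ : t ≤ τ) :
    ‖deriv (Fterm b t) z‖ ≤ (Cst * t ^ 5 * Real.exp (-(z ^ 2).re / (4 * τ)) / (1 + ‖z‖) ^ 3) *
      (1 / ((n : ℝ) + 1) ^ 2) := by
  have hn : (0 : ℝ) ≤ n := n.cast_nonneg
  have hx : 0 < z.re := hz.1
  have hb1 : 1 ≤ b := by linarith
  rw [(hasDerivAt_Fterm b t z).deriv, norm_mul]
  have hzn := norm_le_two_re hz
  set X := z.re + b with hXdef
  have hX : 0 < X := by linarith
  have h1 : ‖-(z + b) / (2 * (t : ℂ))‖ ≤ X / t := by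
    rw [norm_div, norm_neg, norm_mul, Complex.norm_real, Real.norm_of_nonneg ht.le,
      Complex.norm_ofNat]
    have : ‖z + b‖ ≤ 2 * X := by
      refine (norm_add_le _ _).trans ?_
      rw [Complex.norm_real, Real.norm_of_nonneg (by linarith)]
      linarith
    rw [div_le_div_iff₀ (by positivity) ht]
    nlinarith
  set E := Real.exp (-(z ^ 2).re / (4 * τ))
  have hE : 0 ≤ E := Real.exp_nonneg _
  have hXn : (1 + ‖z‖) / 2 ≤ X := by linarith
  have hXN : (n : ℝ) + 1 ≤ X := by linarith
  have h5 : ((1 + ‖z‖) / 2) ^ 3 * ((n : ℝ) + 1) ^ 2 ≤ X ^ 5 := by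
    calc ((1 + ‖z‖) / 2) ^ 3 * ((n : ℝ) + 1) ^ 2 ≤ X ^ 3 * X ^ 2 := by gcongr
      _ = X ^ 5 := by ring
  calc _ ≤ (X / t) * (E * (720 * 4 ^ 6 * t ^ 6 / X ^ 6)) := by
        gcongr
        exact norm_Fterm_le hz hb1 ht htτ
    _ = (720 * 4 ^ 6 * t ^ 5 * E) / X ^ 5 := by field_simp
    _ ≤ (720 * 4 ^ 6 * t ^ 5 * E) / (((1 + ‖z‖) / 2) ^ 3 * ((n : ℝ) + 1) ^ 2) := by
        gcongr
    _ = _ := by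
        rw [Cst]; field_simp; ring

/-- Half-theta series with first shift `c`. -/
def Ser (c t : ℝ) (z : ℂ) : ℂ := ∑' n : ℕ, Fterm (c + 2 * Real.pi * n) t z

lemma summable_sq : Summable (fun n : ℕ => 1 / ((n : ℝ) + 1) ^ 2) := by
  have h := (summable_nat_add_iff 1).2 (Real.summable_one_div_nat_pow.2 (by norm_num : 1 < 2))
  simpa using h

lemma shift_ge {c : ℝ} (hc : 1 ≤ c) (n : ℕ) : (n : ℝ) + 1 ≤ c + 2 * Real.pi * n := by
  have hn : (0 : ℝ) ≤ n := n.cast_nonneg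
  nlinarith [Real.pi_gt_three]

lemma Fterm_summable_bound {c t : ℝ} (hc : 1 ≤ c) (ht : 0 < t) (n : ℕ) (z : ℂ)
    (hz : z ∈ SectorDelta) :
    ‖Fterm (c + 2 * Real.pi * n) t z‖ ≤ 720 * 4 ^ 6 * t ^ 6 * (1 / ((n : ℝ) + 1) ^ 2) := by
  have hn : (0 : ℝ) ≤ n := n.cast_nonneg
  have hb := shift_ge hc n
  have hx : 0 < z.re := hz.1
  have h := norm_Fterm_le hz (by linarith : 1 ≤ c + 2 * Real.pi * n) ht le_rfl
  refine h.trans ?_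
  have hE : Real.exp (-(z ^ 2).re / (4 * t)) ≤ 1 := by
    apply Real.exp_le_one_iff.2
    apply div_nonpos_of_nonpos_of_nonneg _ (by positivity)
    linarith [re_sq_pos hz]
  set X := z.re + (c + 2 * Real.pi * n)
  have hX : (n : ℝ) + 1 ≤ X := by linarith
  have hX6 : ((n : ℝ) + 1) ^ 2 ≤ X ^ 6 := by
    calc ((n : ℝ) + 1) ^ 2 ≤ ((n : ℝ) + 1) ^ 6 := pow_le_pow_right₀ (by linarith) (by norm_num)
      _ ≤ X ^ 6 := by gcongr
  calc _ ≤ 1 * (720 * 4 ^ 6 * t ^ 6 / ((n : ℝ) + 1) ^ 2) := by gcongr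
    _ = _ := by ring

lemma Fterm_diff (b t : ℝ) : Differentiable ℂ (Fterm b t) :=
  fun z => (hasDerivAt_Fterm b t z).differentiableAt

lemma Ser_summable {c t : ℝ} (hc : 1 ≤ c) (ht : 0 < t) {z : ℂ} (hz : z ∈ SectorDelta) :
    Summable (fun n : ℕ => Fterm (c + 2 * Real.pi * n) t z) :=
  Summable.of_norm_bounded (summable_sq.mul_left _) fun n => Fterm_summable_bound hc ht n z hz

lemma Ser_diff {c t : ℝ} (hc : 1 ≤ c) (ht : 0 < t) : DifferentiableOn ℂ (Ser c t) SectorDelta :=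
  Complex.differentiableOn_tsum_of_summable_norm (summable_sq.mul_left (720 * 4 ^ 6 * t ^ 6))
    (fun _ => (Fterm_diff _ _).differentiableOn) sectorDelta_isOpen
    (fun n w hw => Fterm_summable_bound hc ht n w hw)

lemma Ser_deriv {c t : ℝ} (hc : 1 ≤ c) (ht : 0 < t) {z : ℂ} (hz : z ∈ SectorDelta) :
    HasSum (fun n : ℕ => deriv (Fterm (c + 2 * Real.pi * n) t) z) (deriv (Ser c t) z) :=
  Complex.hasSum_deriv_of_summable_norm (summable_sq.mul_left (720 * 4 ^ 6 * t ^ 6))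
    (fun _ => (Fterm_diff _ _).differentiableOn) sectorDelta_isOpen
    (fun n w hw => Fterm_summable_bound hc ht n w hw) hz

/-- The full kernel. -/
def kern (c t : ℝ) (z : ℂ) : ℂ :=
  -(((Real.sqrt (Real.pi * t) : ℝ) : ℂ))⁻¹ * deriv (Ser c t) z

def Sc : ℝ := ∑' n : ℕ, 1 / ((n : ℝ) + 1) ^ 2

lemma Sc_nonneg : 0 ≤ Sc := tsum_nonneg fun n => by positivity

def Bd (τ : ℝ) : ℝ := Cst * Sc * (τ ^ 5 + τ ^ 4)

lemma Cst_pos : 0 < Cst := by unfold Cst; norm_num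

lemma inv_sqrt_le {t : ℝ} (ht : 0 < t) : (Real.sqrt (Real.pi * t))⁻¹ ≤ 1 + 1 / t := by
  have h1 : Real.sqrt t ≤ Real.sqrt (Real.pi * t) :=
    Real.sqrt_le_sqrt (by nlinarith [Real.pi_gt_three])
  have h2 : 0 < Real.sqrt t := Real.sqrt_pos.2 ht
  refine (inv_anti₀ h2 h1).trans ?_
  have h3 : Real.sqrt t ^ 2 = t := Real.sq_sqrt ht.le
  rw [inv_le_iff_one_le_mul₀ h2]
  set s := Real.sqrt t
  rw [← h3]
  have : (1 + 1 / s ^ 2) * s = s + 1 / s := by field_simp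
  rw [this]
  rcases le_total 1 s with h | h
  · have : 0 < 1 / s := by positivity
    linarith
  · have : 1 ≤ 1 / s := by rw [le_div_iff₀ h2]; linarith
    linarith

lemma kern_bound {c t τ : ℝ} (hc : 1 ≤ c) (ht : 0 < t) (htτ : t ≤ τ) {z : ℂ}
    (hz : z ∈ SectorDelta) :
    ‖kern c t z‖ ≤ Bd τ * (Real.exp (-(z ^ 2).re / (4 * τ)) / (1 + ‖z‖) ^ 3) := by
  set Q := Real.exp (-(z ^ 2).re / (4 * τ)) / (1 + ‖z‖) ^ 3 with hQ
  have hQ0 : 0 ≤ Q := by positivity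
  have hd : ‖deriv (Ser c t) z‖ ≤ Cst * t ^ 5 * Q * Sc := by
    rw [← (Ser_deriv hc ht hz).tsum_eq]
    have hs := (summable_sq.hasSum.mul_left (Cst * t ^ 5 * Q))
    refine tsum_of_norm_bounded hs fun n => ?_
    refine (norm_deriv_Fterm_le n hz (shift_ge hc n) ht htτ).trans (le_of_eq ?_)
    rw [hQ]; ring
  rw [kern, norm_mul, norm_neg, norm_inv, Complex.norm_real,
    Real.norm_of_nonneg (Real.sqrt_nonneg _)]
  have hC := Cst_pos
  have hS := Sc_nonneg
  calc _ ≤ (1 + 1 / t) * (Cst * t ^ 5 * Q * Sc) := by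
        gcongr
        exact inv_sqrt_le ht
    _ = Cst * Sc * (t ^ 5 + t ^ 4) * Q := by field_simp
    _ ≤ _ := by
        unfold Bd
        gcongr

lemma Bd_nonneg {τ : ℝ} (hτ : 0 ≤ τ) : 0 ≤ Bd τ := by
  have hC := Cst_pos
  have hS := Sc_nonneg
  unfold Bd
  positivity

lemma kern_diff {c t : ℝ} (hc : 1 ≤ c) (ht : 0 < t) : DifferentiableOn ℂ (kern c t) SectorDelta :=
  ((Ser_diff hc ht).deriv sectorDelta_isOpen).const_mul _

lemma kern_meas {c τ : ℝ} (hc : 1 ≤ c) {z : ℂ} (hz : z ∈ SectorDelta) :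
    AEStronglyMeasurable (fun σ => kern c (τ - σ) z) (volume.restrict (Ioo 0 τ)) := by
  unfold kern
  refine AEStronglyMeasurable.mul ?_ ?_
  · apply Measurable.aestronglyMeasurable
    fun_prop
  · refine aestronglyMeasurable_of_tendsto_ae Filter.atTop
      (f := fun (N : ℕ) σ => ∑ n ∈ Finset.range N,
        deriv (Fterm (c + 2 * Real.pi * n) (τ - σ)) z) ?_ ?_
    · intro N
      apply Measurable.aestronglyMeasurable
      simp_rw [fun b t => (hasDerivAt_Fterm b t z).deriv]
      unfold Fterm
      fun_prop
    · filter_upwards [ae_restrict_mem measurableSet_Ioo] with σ hσ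
      exact (Ser_deriv hc (by linarith [hσ.2]) hz).tendsto_sum_nat

/-- The half remainder operator. -/
def Gop (c τ : ℝ) (f : ℝ → ℂ) (z : ℂ) : ℂ := ∫ σ in Ioo (0 : ℝ) τ, kern c (τ - σ) z * f σ

section
variable {c τ : ℝ} {f : ℝ → ℂ}

lemma ae_bound (hc : 1 ≤ c) {z : ℂ} (hz : z ∈ SectorDelta) :
    ∀ᵐ σ ∂(volume.restrict (Ioo 0 τ)), ‖kern c (τ - σ) z * f σ‖ ≤
      Bd τ * (Real.exp (-(z ^ 2).re / (4 * τ)) / (1 + ‖z‖) ^ 3) * ‖f σ‖ := by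
  filter_upwards [ae_restrict_mem measurableSet_Ioo] with σ hσ
  rw [norm_mul]
  gcongr
  exact kern_bound hc (by linarith [hσ.2]) (by linarith [hσ.1]) hz

lemma Gop_integrable (hc : 1 ≤ c) (hf : Measurable f) (hfi : IntegrableOn f (Ioo 0 τ))
    {z : ℂ} (hz : z ∈ SectorDelta) :
    Integrable (fun σ => kern c (τ - σ) z * f σ) (volume.restrict (Ioo 0 τ)) :=
  (hfi.norm.const_mul _).mono' ((kern_meas hc hz).mul hf.aestronglyMeasurable) (ae_bound hc hz)

lemma Gop_diff (hc : 1 ≤ c) (hτ : 0 < τ) (hf : Measurable f) (hfi : IntegrableOn f (Ioo 0 τ)) :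
    DifferentiableOn ℂ (Gop c τ f) SectorDelta := by
  refine holo_integral sectorDelta_isOpen (fun z σ => kern c (τ - σ) z * f σ)
    (fun σ => Bd τ * ‖f σ‖) (hfi.norm.const_mul _)
    (fun z hz => (kern_meas hc hz).mul hf.aestronglyMeasurable) ?_ ?_
  · filter_upwards [ae_restrict_mem measurableSet_Ioo] with σ hσ
    exact (kern_diff hc (by linarith [hσ.2])).mul_const _
  · filter_upwards [ae_restrict_mem measurableSet_Ioo] with σ hσ z hz
    rw [norm_mul]
    gcongr
    refine (kern_bound hc (by linarith [hσ.2]) (by linarith [hσ.1]) hz).trans ?_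
    have hE : Real.exp (-(z ^ 2).re / (4 * τ)) ≤ 1 := by
      apply Real.exp_le_one_iff.2
      apply div_nonpos_of_nonpos_of_nonneg _ (by positivity)
      linarith [re_sq_pos hz]
    have h1 : (1 : ℝ) ≤ (1 + ‖z‖) ^ 3 := one_le_pow₀ (by linarith [norm_nonneg z])
    have : Real.exp (-(z ^ 2).re / (4 * τ)) / (1 + ‖z‖) ^ 3 ≤ 1 :=
      div_le_one_of_le₀ (hE.trans h1) (by positivity)
    exact mul_le_of_le_one_right (Bd_nonneg hτ.le) this

lemma Gop_bound (hc : 1 ≤ c) (hτ : 0 < τ) (hfi : IntegrableOn f (Ioo 0 τ))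
    (hf2 : IntegrableOn (fun σ => ‖f σ‖ ^ 2) (Ioo 0 τ)) {z : ℂ} (hz : z ∈ SectorDelta) :
    ‖Gop c τ f z‖ ^ 2 * omega0 τ z ≤
      Bd τ ^ 2 * (∫ σ in Ioo 0 τ, ‖f σ‖ ^ 2) * (1 / (1 + ‖z‖) ^ 6) := by
  have hB := Bd_nonneg hτ.le
  set E := Real.exp (-(z ^ 2).re / (4 * τ)) with hEdef
  have h1 : ‖Gop c τ f z‖ ≤ Bd τ * (E / (1 + ‖z‖) ^ 3) * ∫ σ in Ioo 0 τ, ‖f σ‖ := by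
    rw [← integral_const_mul]
    exact norm_integral_le_of_norm_le (hfi.norm.const_mul _) (ae_bound hc hz)
  have h2 := cs_Ioo hτ (fun σ => ‖f σ‖) hfi.norm hf2
  set J := ∫ σ in Ioo 0 τ, ‖f σ‖
  set S := ∫ σ in Ioo 0 τ, ‖f σ‖ ^ 2
  have hE : E ^ 2 * Real.exp ((z ^ 2).re / (2 * τ)) = 1 := by
    rw [hEdef, ← Real.exp_nat_mul, ← Real.exp_add]
    convert! Real.exp_zero using 2
    field_simp
    push_cast
    ring
  have hom : 0 ≤ omega0 τ z := by unfold omega0; positivity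
  calc ‖Gop c τ f z‖ ^ 2 * omega0 τ z
      ≤ (Bd τ * (E / (1 + ‖z‖) ^ 3) * J) ^ 2 * omega0 τ z := by gcongr
    _ = (Bd τ / (1 + ‖z‖) ^ 3) ^ 2 * (J ^ 2 / τ) * (E ^ 2 * Real.exp ((z ^ 2).re / (2 * τ))) := by
        unfold omega0; ring
    _ = (Bd τ / (1 + ‖z‖) ^ 3) ^ 2 * (J ^ 2 / τ) := by rw [hE, mul_one]
    _ ≤ (Bd τ / (1 + ‖z‖) ^ 3) ^ 2 * S := by
        gcongr
        rw [div_le_iff₀ hτ]; linarith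
    _ = _ := by field_simp

end

lemma integrable_six : Integrable (fun z : ℂ => 1 / (1 + ‖z‖) ^ 6) := by
  have h := integrable_one_add_norm (E := ℂ) (μ := volume) (r := 6)
    (by rw [Complex.finrank_real_complex]; norm_num)
  refine h.congr (Filter.Eventually.of_forall fun z => ?_)
  have : (0 : ℝ) < 1 + ‖z‖ := by positivity
  simp only
  rw [Real.rpow_neg this.le]
  norm_cast
  simp

def Isix : ℝ := ∫ z : ℂ, 1 / (1 + ‖z‖) ^ 6

lemma Isix_nonneg : 0 ≤ Isix := integral_nonneg fun z => by positivity

lemma lintegral_six (A : ℝ) (hA : 0 ≤ A) :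
    ∫⁻ z : ℂ, ENNReal.ofReal (A * (1 / (1 + ‖z‖) ^ 6)) = ENNReal.ofReal (A * Isix) := by
  rw [← ofReal_integral_eq_lintegral_ofReal (integrable_six.const_mul A)
    (Filter.Eventually.of_forall fun z => by positivity), integral_const_mul]
  rfl

lemma Ktilde_eq {t : ℝ} (ht : 0 < t) {s : ℂ} (hs : s ∈ SquareD) :
    Ktilde t s = -(((Real.sqrt (Real.pi * t) : ℝ) : ℂ))⁻¹ *
      (Ser (2 * Real.pi) t s + Ser Real.pi t (Real.pi - s)) := by
  have hpi := Real.pi_gt_three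
  unfold Ktilde
  congr 1
  set g : ℤ → ℂ := fun m => Complex.exp (-(s + 2 * (m : ℂ) * (Real.pi : ℂ)) ^ 2 / (4 * (t : ℂ)))
    with hg
  have h1 := (Ser_summable (c := 2 * Real.pi) (by linarith) ht hs.1).hasSum
  have h2 := (Ser_summable (c := Real.pi) (by linarith) ht ((mem_sectorPiDelta s).1 hs.2)).hasSum
  have key : HasSum ({m : ℤ | m ≠ 0}.indicator g)
      (Ser (2 * Real.pi) t s + Ser Real.pi t (Real.pi - s)) := by
    apply HasSum.of_nat_of_neg_add_one
    · rw [← hasSum_nat_add_iff' 1]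
      convert! h1 using 1
      · ext n
        have : ((n + 1 : ℕ) : ℤ) ∈ {m : ℤ | m ≠ 0} := by
          simp only [mem_ofPred_eq]; omega
        rw [indicator_of_mem this, hg, Fterm]
        push_cast
        congr 3
        ring
      · simp [Ser]
    · convert! h2 using 1
      ext n
      have : -((n : ℤ) + 1) ∈ {m : ℤ | m ≠ 0} := by
        simp only [mem_ofPred_eq]; omega
      rw [indicator_of_mem this, hg, Fterm]
      push_cast
      congr 2
      ring
  exact (hasSum_subtype_iff_indicator.2 key).tsum_eq

lemma deriv_Ktilde {t : ℝ} (ht : 0 < t) {s : ℂ} (hs : s ∈ SquareD) :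
    deriv (Ktilde t) s = kern (2 * Real.pi) t s - kern Real.pi t (Real.pi - s) := by
  have hpi := Real.pi_gt_three
  have hs2 := (mem_sectorPiDelta s).1 hs.2
  have hopen : IsOpen SquareD := sectorDelta_isOpen.inter sectorPiDelta_isOpen
  have h1 := (((Ser_diff (c := 2 * Real.pi) (by linarith) ht) s hs.1).differentiableAt
    (sectorDelta_isOpen.mem_nhds hs.1)).hasDerivAt
  have h2 := (((Ser_diff (c := Real.pi) (by linarith) ht) _ hs2).differentiableAt
    (sectorDelta_isOpen.mem_nhds hs2)).hasDerivAt
  have h3 := h2.comp_const_sub (Real.pi : ℂ) s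
  have h4 := (h1.add h3).const_mul (-(((Real.sqrt (Real.pi * t) : ℝ) : ℂ))⁻¹)
  have h5 : HasDerivAt (Ktilde t) _ s := h4.congr_of_eventuallyEq
    (Filter.eventually_of_mem (hopen.mem_nhds hs) fun w hw => Ktilde_eq ht hw)
  rw [h5.deriv, kern, kern]
  ring

/-- `R_{0,τ}` is bounded from `L²(0,τ)` into `A²(Δ, ω₀) + A²(π−Δ, ω_π)`, with norm
tending to `0` as `τ → 0`. -/
theorem remainder_bounded_into_weighted_sum :
    ∃ C : ℝ → ℝ, (∀ τ : ℝ, 0 ≤ C τ) ∧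
      Filter.Tendsto C (nhdsWithin 0 (Ioi 0)) (nhds 0) ∧
      ∀ τ : ℝ, 0 < τ → ∀ f : ℝ → ℂ, Measurable f →
        (∫⁻ σ in Ioo (0:ℝ) τ, ENNReal.ofReal (‖f σ‖ ^ 2) < ⊤) →
        ∃ g₁ g₂ : ℂ → ℂ,
          DifferentiableOn ℂ g₁ SectorDelta ∧ DifferentiableOn ℂ g₂ SectorPiDelta ∧
          (∀ s ∈ SquareD, Rop τ f s = g₁ s + g₂ s) ∧
          (∫⁻ z in SectorDelta, ENNReal.ofReal (‖g₁ z‖ ^ 2 * omega0 τ z)) +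
            (∫⁻ z in SectorPiDelta, ENNReal.ofReal (‖g₂ z‖ ^ 2 * omegaPi τ z))
            ≤ ENNReal.ofReal (C τ ^ 2) *
                ∫⁻ σ in Ioo (0:ℝ) τ, ENNReal.ofReal (‖f σ‖ ^ 2) := by
  have hpi := Real.pi_gt_three
  refine ⟨fun τ => Real.sqrt (2 * (Bd τ ^ 2 * Isix)), fun τ => Real.sqrt_nonneg _, ?_, ?_⟩
  · have hcont : Continuous fun τ => Real.sqrt (2 * (Bd τ ^ 2 * Isix)) := by
      unfold Bd
      fun_prop
    have h := hcont.tendsto 0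
    have h0 : Real.sqrt (2 * (Bd 0 ^ 2 * Isix)) = 0 := by simp [Bd]
    rw [h0] at h
    exact h.mono_left nhdsWithin_le_nhds
  intro τ hτ f hf hfin
  have hf2 : IntegrableOn (fun σ => ‖f σ‖ ^ 2) (Ioo 0 τ) := by
    refine ⟨(hf.norm.pow_const 2).aestronglyMeasurable, ?_⟩
    rw [hasFiniteIntegral_iff_ofReal (Filter.Eventually.of_forall fun σ => by positivity)]
    exact hfin
  have hfi : IntegrableOn f (Ioo 0 τ) := by
    have h1 : IntegrableOn (fun _ : ℝ => (1 : ℝ)) (Ioo 0 τ) := integrable_const _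
    refine (Integrable.add h1 hf2).mono' hf.aestronglyMeasurable
      (Filter.Eventually.of_forall fun σ => ?_)
    simp only [Pi.add_apply]
    nlinarith [sq_nonneg (‖f σ‖ - 1)]
  have hS : ∫⁻ σ in Ioo (0:ℝ) τ, ENNReal.ofReal (‖f σ‖ ^ 2)
      = ENNReal.ofReal (∫ σ in Ioo 0 τ, ‖f σ‖ ^ 2) :=
    (ofReal_integral_eq_lintegral_ofReal hf2
      (Filter.Eventually.of_forall fun σ => by positivity)).symm
  have hS0 : 0 ≤ ∫ σ in Ioo 0 τ, ‖f σ‖ ^ 2 := integral_nonneg fun σ => by positivity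
  have hI := Isix_nonneg
  have h2pi : (1 : ℝ) ≤ 2 * Real.pi := by linarith
  have h1pi : (1 : ℝ) ≤ Real.pi := by linarith
  refine ⟨Gop (2 * Real.pi) τ f, fun z => -Gop Real.pi τ f (Real.pi - z),
    Gop_diff h2pi hτ hf hfi, ?_, ?_, ?_⟩
  · refine ((Gop_diff h1pi hτ hf hfi).comp (t := SectorDelta) (by fun_prop) ?_).neg
    intro z hz
    exact (mem_sectorPiDelta z).1 hz
  · intro s hs
    have hs2 := (mem_sectorPiDelta s).1 hs.2
    rw [← sub_eq_add_neg, Gop, Gop, ← integral_sub (Gop_integrable h2pi hf hfi hs.1)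
      (Gop_integrable h1pi hf hfi hs2), Rop]
    apply setIntegral_congr_fun measurableSet_Ioo
    intro σ hσ
    simp only
    rw [deriv_Ktilde (by linarith [hσ.2]) hs]
    ring
  · rw [hS, Real.sq_sqrt (by positivity), ← ENNReal.ofReal_mul (by positivity)]
    set S := ∫ σ in Ioo 0 τ, ‖f σ‖ ^ 2
    have hA : 0 ≤ Bd τ ^ 2 * S := by positivity
    have e : 2 * (Bd τ ^ 2 * Isix) * S = Bd τ ^ 2 * S * Isix + Bd τ ^ 2 * S * Isix := by ring
    rw [e, ENNReal.ofReal_add (by positivity) (by positivity), ← lintegral_six _ hA]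
    gcongr ?_ + ?_
    · refine le_trans (setLIntegral_mono' sectorDelta_isOpen.measurableSet fun z hz => ?_)
        (setLIntegral_le_lintegral SectorDelta _)
      exact ENNReal.ofReal_le_ofReal (Gop_bound h2pi hτ hfi hf2 hz)
    · rw [← lintegral_sub_left_eq_self
        (fun z : ℂ => ENNReal.ofReal (Bd τ ^ 2 * S * (1 / (1 + ‖z‖) ^ 6))) (Real.pi : ℂ)]
      refine le_trans (setLIntegral_mono' sectorPiDelta_isOpen.measurableSet fun z hz => ?_)
        (setLIntegral_le_lintegral SectorPiDelta _)
      rw [norm_neg]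
      exact ENNReal.ofReal_le_ofReal
        (Gop_bound h1pi hτ hfi hf2 ((mem_sectorPiDelta z).1 hz))

end
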